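/- Let N ≥ 3. There exists a constant c > 0 such that for every x ∈ ℝ^N, ∫_{ℝ^N} |x−y|^{−(N−2)} · U(y)^{(N+2)/(N−2)} dy = c · U(x); in particular the integral on the left is finite for every x, and the Newtonian potential of U^{(N+2)/(N−2)} is a constant multiple of U. -/

import Mathlib

open scoped BigOperators

/-- The standard bubble `U(x) = (N(N-2))^((N-2)/4) (1+|x|^2)^(-(N-2)/2)`. -/
noncomputable def U (N : ℕ) (x : EuclideanSpace ℝ (Fin N)) : ℝ :=
  ((N : ℝ) * ((N : ℝ) - 2)) ^ (((N : ℝ) - 2) / 4) * (1 + ‖x‖ ^ 2) ^ (-(((N : ℝ) - 2) / 2))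

open MeasureTheory EuclideanGeometry

theorem aux_powers (N : ℕ) (s d A q w : ℝ) (hs : 0 < s) (hd : 0 < d) (hA : 0 < A)
    (hq : 0 ≤ q) (hw : 0 < w) :
    (s / d ^ 2) ^ N * ((s / (A * d) * q) ^ (-((N : ℝ) - 2)) *
      (s * w / d ^ 2) ^ (-(((N : ℝ) + 2) / 2))) =
    (s / A ^ 2) ^ (-(((N : ℝ) - 2) / 2)) *
      (q ^ (-((N : ℝ) - 2)) * w ^ (-(((N : ℝ) + 2) / 2))) := by
  have e1 : s * w / d ^ 2 = (s / d ^ 2) * w := by ring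
  rw [e1, Real.mul_rpow (by positivity) hq, Real.mul_rpow (by positivity) hw.le,
    ← Real.rpow_natCast (s / d ^ 2) N]
  have key : (s / d ^ 2) ^ (N : ℝ) * ((s / (A * d)) ^ (-((N : ℝ) - 2)) *
      (s / d ^ 2) ^ (-(((N : ℝ) + 2) / 2))) = (s / A ^ 2) ^ (-(((N : ℝ) - 2) / 2)) := by
    obtain ⟨a, rfl⟩ : ∃ a, s = Real.exp a := ⟨Real.log s, (Real.exp_log hs).symm⟩
    obtain ⟨b, rfl⟩ : ∃ a, d = Real.exp a := ⟨Real.log d, (Real.exp_log hd).symm⟩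
    obtain ⟨c, rfl⟩ : ∃ a, A = Real.exp a := ⟨Real.log A, (Real.exp_log hA).symm⟩
    simp only [pow_two, ← Real.exp_add, ← Real.exp_sub, ← Real.exp_mul]
    congr 1
    ring
  rw [← key]
  ring

theorem aux_det {E : Type*} [NormedAddCommGroup E] [InnerProductSpace ℝ E] [FiniteDimensional ℝ E]
    (K : Submodule ℝ E) [K.HasOrthogonalProjection] (t : ℝ) (ht : 0 ≤ t) :
    |(t • (K.reflection : E →L[ℝ] E)).det| = t ^ (Module.finrank ℝ E) := by
  have h1 : (t • (K.reflection : E →L[ℝ] E)).det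
      = t ^ (Module.finrank ℝ E) * LinearMap.det (K.reflection : E →ₗ[ℝ] E) := by
    rw [ContinuousLinearMap.det]
    exact LinearMap.det_smul t _
  have h2 : LinearMap.det (K.reflection : E →ₗ[ℝ] E) * LinearMap.det (K.reflection : E →ₗ[ℝ] E)
      = 1 := by
    rw [← LinearMap.det_comp]
    convert LinearMap.det_id
    ext x
    simp
  have h3 : |LinearMap.det (K.reflection : E →ₗ[ℝ] E)| = 1 := by
    rcases mul_self_eq_one_iff.1 h2 with h | h <;> simp [h]
  rw [h1, abs_mul, h3, abs_of_nonneg (by positivity), mul_one]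

theorem aux_norm {E : Type*} [NormedAddCommGroup E] [InnerProductSpace ℝ E]
    (a z : E) (hz : z ≠ a) (R : ℝ) (hR : R ^ 2 = 1 + ‖a‖ ^ 2) :
    1 + ‖inversion a R z‖ ^ 2 = R ^ 2 * (1 + ‖z‖ ^ 2) / (dist z a) ^ 2 := by
  have hd : ‖z - a‖ ≠ 0 := norm_ne_zero_iff.2 (sub_ne_zero.2 hz)
  have hz2 : ‖z‖ ^ 2 = ‖z - a‖ ^ 2 + 2 * inner ℝ (z - a) a + ‖a‖ ^ 2 := by
    rw [← norm_add_sq_real]; simp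
  rw [inversion, dist_eq_norm, vsub_eq_sub, vadd_eq_add, norm_add_sq_real, norm_smul,
    inner_smul_left, hz2]
  simp only [conj_trivial, norm_pow, norm_div, norm_norm, div_pow, mul_pow, Real.norm_eq_abs, sq_abs]
  rw [hR]
  field_simp
  ring

theorem aux_inv {E : Type*} [NormedAddCommGroup E] [InnerProductSpace ℝ E]
    (x : E) (hx : x ≠ 0) (R : ℝ) (hR : R ^ 2 = 1 + ‖-((‖x‖ ^ 2)⁻¹ • x)‖ ^ 2) :
    inversion (-((‖x‖ ^ 2)⁻¹ • x)) R 0 = x := by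
  have hd : ‖x‖ ≠ 0 := norm_ne_zero_iff.2 hx
  rw [inversion, div_pow, hR, dist_eq_norm, vsub_eq_sub, vadd_eq_add]
  simp only [zero_sub, neg_neg, norm_smul, norm_neg, norm_inv, norm_pow, norm_norm]
  rw [← sub_eq_add_neg, smul_smul, ← sub_smul]
  convert one_smul ℝ x
  field_simp
  ring

theorem aux_integrable (N : ℕ) (hN : 3 ≤ N) :
    Integrable (fun y : EuclideanSpace ℝ (Fin N) =>
      ‖y‖ ^ (-((N : ℝ) - 2)) * (1 + ‖y‖ ^ 2) ^ (-(((N : ℝ) + 2) / 2))) := by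
  haveI : Nonempty (Fin N) := ⟨⟨0, by omega⟩⟩
  have hN' : (3 : ℝ) ≤ N := by exact_mod_cast hN
  rw [integrable_fun_norm_addHaar (E := EuclideanSpace ℝ (Fin N)) volume
    (f := fun r : ℝ => r ^ (-((N : ℝ) - 2)) * (1 + r ^ 2) ^ (-(((N : ℝ) + 2) / 2)))]
  refine Integrable.mono' (integrable_inv_one_add_sq.integrableOn (s := Set.Ioi 0)) ?_ ?_
  · exact Measurable.aestronglyMeasurable (by fun_prop)
  · refine (ae_restrict_iff' measurableSet_Ioi).2 (Filter.Eventually.of_forall ?_)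
    intro r (hr : 0 < r)
    have h1 : r ^ (N - 1) * r ^ (-((N : ℝ) - 2)) = r := by
      rw [← Real.rpow_natCast, ← Real.rpow_add hr, Nat.cast_sub (by omega)]
      convert Real.rpow_one r using 2
      push_cast; ring
    rw [finrank_euclideanSpace_fin, smul_eq_mul, ← mul_assoc, h1, Real.norm_of_nonneg (by positivity)]
    calc r * (1 + r ^ 2) ^ (-(((N : ℝ) + 2) / 2))
        ≤ (1 + r ^ 2) * (1 + r ^ 2) ^ (-2 : ℝ) := by
          gcongr
          · nlinarith [sq_nonneg (r - 1)]
          · nlinarith [sq_nonneg r]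
          · linarith
      _ = (1 + r ^ 2)⁻¹ := by
          have : (0 : ℝ) < 1 + r ^ 2 := by positivity
          rw [Real.rpow_neg this.le, Real.rpow_two]
          field_simp

theorem aux_main (N : ℕ) (hN : 3 ≤ N) (x : EuclideanSpace ℝ (Fin N)) :
    Integrable (fun y : EuclideanSpace ℝ (Fin N) =>
      ‖x - y‖ ^ (-((N : ℝ) - 2)) * (1 + ‖y‖ ^ 2) ^ (-(((N : ℝ) + 2) / 2))) ∧
    (∫ y : EuclideanSpace ℝ (Fin N),
      ‖x - y‖ ^ (-((N : ℝ) - 2)) * (1 + ‖y‖ ^ 2) ^ (-(((N : ℝ) + 2) / 2))) =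
    (1 + ‖x‖ ^ 2) ^ (-(((N : ℝ) - 2) / 2)) * ∫ y : EuclideanSpace ℝ (Fin N),
      ‖y‖ ^ (-((N : ℝ) - 2)) * (1 + ‖y‖ ^ 2) ^ (-(((N : ℝ) + 2) / 2)) := by
  have hI := aux_integrable N hN
  haveI : Nonempty (Fin N) := ⟨⟨0, by omega⟩⟩
  by_cases hx : x = 0
  · subst hx
    simpa using hI
  set g : EuclideanSpace ℝ (Fin N) → ℝ := fun y =>
      ‖x - y‖ ^ (-((N : ℝ) - 2)) * (1 + ‖y‖ ^ 2) ^ (-(((N : ℝ) + 2) / 2)) with hg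
  have hxn : 0 < ‖x‖ := norm_pos_iff.2 hx
  obtain ⟨a, ha⟩ : ∃ a, a = -((‖x‖ ^ 2)⁻¹ • x) := ⟨_, rfl⟩
  have han : ‖a‖ = ‖x‖⁻¹ := by
    rw [ha, norm_neg, norm_smul, norm_inv, norm_pow, norm_norm]
    field_simp
  have ha0 : 0 < ‖a‖ := by rw [han]; positivity
  obtain ⟨R, hR⟩ : ∃ R, R = Real.sqrt (1 + ‖a‖ ^ 2) := ⟨_, rfl⟩
  have hR2 : R ^ 2 = 1 + ‖a‖ ^ 2 := by rw [hR, Real.sq_sqrt (by positivity)]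
  have hR0 : R ≠ 0 := by rw [hR]; positivity
  have hT : inversion a R 0 = x := by
    subst ha
    exact aux_inv x hx R hR2
  have him : inversion a R '' {a}ᶜ = {a}ᶜ := by
    rw [Set.image_compl_eq (inversion_bijective a hR0)]
    simp
  have hder : ∀ z ∈ ({a}ᶜ : Set (EuclideanSpace ℝ (Fin N))),
      HasFDerivWithinAt (inversion a R) ((R / dist z a) ^ 2 •
        ((Submodule.span ℝ {z - a})ᗮ.reflection :
          EuclideanSpace ℝ (Fin N) →L[ℝ] EuclideanSpace ℝ (Fin N))) {a}ᶜ z :=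
    fun z hz => (hasFDerivAt_inversion hz).hasFDerivWithinAt
  have hms : MeasurableSet ({a}ᶜ : Set (EuclideanSpace ℝ (Fin N))) :=
    (measurableSet_singleton a).compl
  have hae : (({a}ᶜ : Set (EuclideanSpace ℝ (Fin N)))) =ᵐ[volume] Set.univ := by
    rw [ae_eq_univ]; simp
  have hinj := (inversion_injective a hR0).injOn (s := {a}ᶜ)
  have hpt : ∀ z ∈ ({a}ᶜ : Set (EuclideanSpace ℝ (Fin N))),
      |((R / dist z a) ^ 2 • ((Submodule.span ℝ {z - a})ᗮ.reflection :
          EuclideanSpace ℝ (Fin N) →L[ℝ] EuclideanSpace ℝ (Fin N))).det| • g (inversion a R z)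
      = (1 + ‖x‖ ^ 2) ^ (-(((N : ℝ) - 2) / 2)) * (‖z‖ ^ (-((N : ℝ) - 2)) *
        (1 + ‖z‖ ^ 2) ^ (-(((N : ℝ) + 2) / 2))) := by
    intro z hz
    have hz' : z ≠ a := hz
    have hda : 0 < dist z a := dist_pos.2 hz'
    have h0a : (0 : EuclideanSpace ℝ (Fin N)) ≠ a := (norm_pos_iff.1 ha0).symm
    have hdist : ‖x - inversion a R z‖ = R ^ 2 / (‖a‖ * dist z a) * ‖z‖ := by
      have := dist_inversion_inversion h0a hz' R
      rw [hT] at this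
      rw [← dist_eq_norm, this, dist_zero_left, dist_zero_left]
    have hx2 : 1 + ‖x‖ ^ 2 = R ^ 2 / ‖a‖ ^ 2 := by
      rw [hR2, han]; field_simp; ring
    rw [aux_det _ _ (by positivity), finrank_euclideanSpace_fin, hg, smul_eq_mul]
    simp only
    rw [hdist, aux_norm a z hz' R hR2, hx2, div_pow]
    exact aux_powers N (R ^ 2) (dist z a) ‖a‖ ‖z‖ (1 + ‖z‖ ^ 2) (by positivity) hda ha0
      (norm_nonneg _) (by positivity)
  constructor
  · rw [← integrableOn_univ, ← integrableOn_congr_set_ae hae, ← him,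
      integrableOn_image_iff_integrableOn_abs_det_fderiv_smul volume hms hder hinj,
      integrableOn_congr_fun hpt hms]
    exact (hI.const_mul _).integrableOn
  · rw [← setIntegral_univ, ← setIntegral_congr_set hae, ← him,
      integral_image_eq_integral_abs_det_fderiv_smul volume hms hder hinj,
      setIntegral_congr_fun hms hpt, setIntegral_congr_set hae, setIntegral_univ,
      integral_const_mul]

theorem aux_pos (N : ℕ) (hN : 3 ≤ N) : 0 < ∫ y : EuclideanSpace ℝ (Fin N),
      ‖y‖ ^ (-((N : ℝ) - 2)) * (1 + ‖y‖ ^ 2) ^ (-(((N : ℝ) + 2) / 2)) := by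
  haveI : Nonempty (Fin N) := ⟨⟨0, by omega⟩⟩
  rw [integral_pos_iff_support_of_nonneg (fun y => by positivity) (aux_integrable N hN)]
  refine lt_of_lt_of_le ?_ (measure_mono (s := {0}ᶜ) ?_)
  · exact isOpen_compl_singleton.measure_pos _ (Set.nonempty_compl_of_nontrivial 0)
  · intro y hy
    have : 0 < ‖y‖ := norm_pos_iff.2 hy
    exact (by positivity : (0 : ℝ) < ‖y‖ ^ (-((N : ℝ) - 2)) *
      (1 + ‖y‖ ^ 2) ^ (-(((N : ℝ) + 2) / 2))).ne'

theorem statement9 (N : ℕ) (hN : 3 ≤ N) :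
    ∃ c > (0 : ℝ), ∀ x : EuclideanSpace ℝ (Fin N),
      MeasureTheory.Integrable
        (fun y : EuclideanSpace ℝ (Fin N) =>
          ‖x - y‖ ^ (-((N : ℝ) - 2)) * U N y ^ (((N : ℝ) + 2) / ((N : ℝ) - 2))) ∧
      (∫ y : EuclideanSpace ℝ (Fin N),
          ‖x - y‖ ^ (-((N : ℝ) - 2)) * U N y ^ (((N : ℝ) + 2) / ((N : ℝ) - 2))) = c * U N x := by
  have hN' : (3 : ℝ) ≤ N := by exact_mod_cast hN
  have hN2 : (0 : ℝ) < (N : ℝ) - 2 := by linarith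
  have hP := aux_pos N hN
  obtain ⟨K, hK⟩ : ∃ K, K = ((N : ℝ) * ((N : ℝ) - 2)) ^ (((N : ℝ) - 2) / 4) := ⟨_, rfl⟩
  have hK0 : 0 < K := by rw [hK]; positivity
  have hU : ∀ x y : EuclideanSpace ℝ (Fin N),
      ‖x - y‖ ^ (-((N : ℝ) - 2)) * U N y ^ (((N : ℝ) + 2) / ((N : ℝ) - 2)) =
      K ^ (((N : ℝ) + 2) / ((N : ℝ) - 2)) * (‖x - y‖ ^ (-((N : ℝ) - 2)) *
        (1 + ‖y‖ ^ 2) ^ (-(((N : ℝ) + 2) / 2))) := by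
    intro x y
    have e : -(((N : ℝ) - 2) / 2) * (((N : ℝ) + 2) / ((N : ℝ) - 2)) = -(((N : ℝ) + 2) / 2) := by
      field_simp
    rw [U, ← hK, Real.mul_rpow hK0.le (by positivity), ← Real.rpow_mul (by positivity), e]
    ring
  simp only [hU]
  refine ⟨K ^ (((N : ℝ) + 2) / ((N : ℝ) - 2)) * (∫ y : EuclideanSpace ℝ (Fin N),
      ‖y‖ ^ (-((N : ℝ) - 2)) * (1 + ‖y‖ ^ 2) ^ (-(((N : ℝ) + 2) / 2))) / K, by positivity,
      fun x => ?_⟩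
  obtain ⟨h1, h2⟩ := aux_main N hN x
  refine ⟨h1.const_mul _, ?_⟩
  rw [integral_const_mul, h2, U, ← hK]
  field_simp
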